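/- arXiv:1305.6091 — 4 statements merged into one kernel-verified Lean document; each statement's English description precedes it below -/
import Mathlib

section
/- Let φ₁, …, φ_N ∈ ℝ and c₁, …, c_N ≥ 0, and set J = ∑_{j=1}^N c_j Jr(φ_j). Then J is a real symmetric positive semidefinite 2×2 matrix with trace(J) = ∑_j c_j and (trace J)² − 4·det(J) = ‖∑_j c_j u(2φ_j)‖²; consequently the two eigenvalues of J are μ₁, μ₂ = (1/2)( ∑_j c_j ± ‖∑_j c_j u(2φ_j)‖ ). -/
open Matrix Real Set BigOperators

/-- The unit vector `u(φ) = (cos φ, sin φ)ᵀ`. -/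
noncomputable def uvec (φ : ℝ) : Fin 2 → ℝ := ![Real.cos φ, Real.sin φ]

/-- The ranging direction matrix `Jr(φ) = u(φ) u(φ)ᵀ`. -/
noncomputable def Jrm (φ : ℝ) : Matrix (Fin 2) (Fin 2) ℝ := vecMulVec (uvec φ) (uvec φ)

/-- The Euclidean (ℓ²) norm of a vector in `ℝ²`. -/
noncomputable def enorm2 (v : Fin 2 → ℝ) : ℝ := ‖(WithLp.equiv 2 (Fin 2 → ℝ)).symm v‖

lemma enorm2_sq (v : Fin 2 → ℝ) : enorm2 v ^ 2 = v 0 ^ 2 + v 1 ^ 2 := by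
  simp [enorm2, EuclideanSpace.norm_sq_eq, Fin.sum_univ_two]

lemma posSemidef_Jrm (φ : ℝ) : (Jrm φ).PosSemidef := by
  simpa [Jrm] using posSemidef_vecMulVec_self_star (uvec φ)

lemma trace_Jrm (φ : ℝ) : (Jrm φ).trace = 1 := by
  simp [Jrm, uvec, Matrix.trace, Fin.sum_univ_two, ← sq]

lemma uvec_two_mul (φ : ℝ) :
    uvec (2 * φ) = ![Jrm φ 0 0 - Jrm φ 1 1, 2 * Jrm φ 0 1] := by
  simp only [uvec, Jrm, vecMulVec_apply, Real.cos_two_mul', Real.sin_two_mul]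
  ext i
  fin_cases i <;> simp <;> ring

/-- Two reals are determined, up to order, by their sum and the square of their difference. -/
lemma pair_eq_of_add_eq_of_sub_sq_eq {p q s d : ℝ} (hs : p + q = s) (hd : (p - q) ^ 2 = d ^ 2) :
    ({p, q} : Multiset ℝ) = {(1 / 2) * (s + d), (1 / 2) * (s - d)} := by
  rcases sq_eq_sq_iff_eq_or_eq_neg.mp hd with h | h
  · congr 2 <;> linarith
  · rw [Multiset.pair_comm]
    congr 2 <;> linarith

/-- For `J = ∑ j, c j • Jr (φ j)` with `c j ≥ 0`, `J` is symmetric positive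
semidefinite, `trace J = ∑ c j`, `(trace J)² − 4 det J = ‖∑ c j • u(2 φ j)‖²`, and the two
eigenvalues of `J` are `(1/2)(∑ c j ± ‖∑ c j • u(2 φ j)‖)`. -/
theorem efim_eigenvalues
    (N : ℕ) (φ : Fin N → ℝ) (c : Fin N → ℝ) (hc : ∀ j, 0 ≤ c j)
    (J : Matrix (Fin 2) (Fin 2) ℝ) (hJ : J = ∑ j, c j • Jrm (φ j)) :
    J.IsSymm ∧ J.PosSemidef ∧
    J.trace = ∑ j, c j ∧
    J.trace ^ 2 - 4 * J.det = (enorm2 (∑ j, c j • uvec (2 * φ j))) ^ 2 ∧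
    ∀ (h : J.IsHermitian),
      ({h.eigenvalues 0, h.eigenvalues 1} : Multiset ℝ) =
        {(1 / 2) * (∑ j, c j + enorm2 (∑ j, c j • uvec (2 * φ j))),
         (1 / 2) * (∑ j, c j - enorm2 (∑ j, c j • uvec (2 * φ j)))} := by
  have hpsd : J.PosSemidef := by
    rw [hJ]
    exact posSemidef_sum _ fun j _ => (posSemidef_Jrm (φ j)).smul (hc j)
  have hsymm : J.IsSymm := by
    simpa [Matrix.IsSymm, Matrix.IsHermitian] using hpsd.isHermitian
  have htrace : J.trace = ∑ j, c j := by
    simp [hJ, trace_sum, trace_smul, trace_Jrm]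
  have hvec : ∑ j, c j • uvec (2 * φ j) = ![J 0 0 - J 1 1, 2 * J 0 1] := by
    ext i
    fin_cases i
    · simp [hJ, uvec_two_mul, Matrix.sum_apply, mul_sub]
    · simp [hJ, uvec_two_mul, Matrix.sum_apply, Finset.mul_sum, mul_left_comm]
  have hdisc : J.trace ^ 2 - 4 * J.det = (enorm2 (∑ j, c j • uvec (2 * φ j))) ^ 2 := by
    rw [enorm2_sq, hvec, trace_fin_two, det_fin_two, hsymm.apply 0 1]
    simp
    ring
  refine ⟨hsymm, hpsd, htrace, hdisc, fun h => ?_⟩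
  have ht := h.trace_eq_sum_eigenvalues
  have hd := h.det_eq_prod_eigenvalues
  simp only [Fin.sum_univ_two, Fin.prod_univ_two, RCLike.ofReal_real_eq_id, id] at ht hd
  apply pair_eq_of_add_eq_of_sub_sq_eq (ht.symm.trans htrace)
  rw [← hdisc, ht, hd]
  ring
end

section
/- The function X ↦ trace(X⁻¹) is convex on the set of real symmetric positive definite n×n matrices: for any positive definite symmetric X, Y and α ∈ [0,1], trace((αX + (1−α)Y)⁻¹) ≤ α·trace(X⁻¹) + (1−α)·trace(Y⁻¹). -/
open Matrix Set

/-- The tangent-plane bound for `X ↦ trace(X⁻¹)` at `Z`. -/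
theorem Matrix.PosDef.two_mul_trace_inv_sub_le {n : Type*} [Fintype n] [DecidableEq n]
    {X Z : Matrix n n ℝ} (hX : X.PosDef) (hZ : Z.PosDef) :
    2 * Z⁻¹.trace - (Z⁻¹ * X * Z⁻¹).trace ≤ X⁻¹.trace := by
  have hXu : IsUnit X.det := (isUnit_iff_isUnit_det X).mp hX.isUnit
  have h := (hX.posSemidef.conjTranspose_mul_mul_same (X⁻¹ - Z⁻¹)).trace_nonneg
  have hH : (X⁻¹ - Z⁻¹)ᴴ = X⁻¹ - Z⁻¹ := (hX.inv.isHermitian.sub hZ.inv.isHermitian).eq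
  have hexp : (X⁻¹ - Z⁻¹) * X * (X⁻¹ - Z⁻¹) = X⁻¹ - Z⁻¹ - (Z⁻¹ - Z⁻¹ * X * Z⁻¹) := by
    rw [sub_mul, nonsing_inv_mul X hXu, sub_mul, one_mul, mul_sub, Matrix.mul_assoc Z⁻¹ X X⁻¹,
      mul_nonsing_inv X hXu, mul_one]
  rw [hH, hexp] at h
  simp only [trace_sub] at h
  linarith

/-- Positive definite matrices are closed under convex combinations. -/
theorem Matrix.PosDef.convex_comb {n : Type*} {X Y : Matrix n n ℝ} (hX : X.PosDef)
    (hY : Y.PosDef) {α : ℝ} (hα : α ∈ Set.Icc (0 : ℝ) 1) :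
    (α • X + (1 - α) • Y).PosDef := by
  rcases hα.1.eq_or_lt with rfl | h
  · simpa using hY
  · exact (hX.smul h).add_posSemidef (hY.posSemidef.smul (sub_nonneg.mpr hα.2))

/-- The function `X ↦ trace(X⁻¹)` is convex on real symmetric positive definite
`n × n` matrices. -/
theorem trace_inv_convex_on_posDef
    {n : ℕ} (X Y : Matrix (Fin n) (Fin n) ℝ)
    (hXsymm : X.IsSymm) (hYsymm : Y.IsSymm)
    (hX : X.PosDef) (hY : Y.PosDef)
    (α : ℝ) (hα : α ∈ Set.Icc (0 : ℝ) 1) :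
    (α • X + (1 - α) • Y)⁻¹.trace ≤ α * X⁻¹.trace + (1 - α) * Y⁻¹.trace := by
  have hZ := hX.convex_comb hY hα
  have hx := mul_le_mul_of_nonneg_left (hX.two_mul_trace_inv_sub_le hZ) hα.1
  have hy := mul_le_mul_of_nonneg_left (hY.two_mul_trace_inv_sub_le hZ) (sub_nonneg.mpr hα.2)
  set Z := α • X + (1 - α) • Y with hZdef
  have hsum : α * (Z⁻¹ * X * Z⁻¹).trace + (1 - α) * (Z⁻¹ * Y * Z⁻¹).trace = Z⁻¹.trace := by
    calc α * (Z⁻¹ * X * Z⁻¹).trace + (1 - α) * (Z⁻¹ * Y * Z⁻¹).trace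
        = (Z⁻¹ * (α • X + (1 - α) • Y) * Z⁻¹).trace := by
          simp only [mul_add, add_mul, Matrix.mul_smul, Matrix.smul_mul, trace_add, trace_smul,
            smul_eq_mul]
      _ = Z⁻¹.trace := by
          rw [← hZdef, nonsing_inv_mul Z ((isUnit_iff_isUnit_det Z).mp hZ.isUnit), one_mul]
  linarith
end

section
/- For all angles φ, φ̂ ∈ ℝ and all δ ∈ ℝ, the 2×2 symmetric matrix Jr(φ) − Jr(φ̂) + δ·I is positive semidefinite if and only if δ ≥ |sin(φ − φ̂)|. -/
open Matrix Real

/-- A matrix `[[δ + p, b], [b, δ - p]]` is positive semidefinite iff `√(p² + b²) ≤ δ`; here the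
square root is given as `|r|`. -/
theorem posSemidef_fin_two_iff_abs_le {p b r : ℝ} (δ : ℝ) (h : p ^ 2 + b ^ 2 = r ^ 2) :
    (!![δ + p, b; b, δ - p]).PosSemidef ↔ |r| ≤ δ := by
  constructor
  · intro hM
    have hdet := hM.det_nonneg
    have htr := hM.trace_nonneg
    rw [Matrix.det_fin_two_of] at hdet
    rw [Matrix.trace_fin_two_of] at htr
    exact abs_le_of_sq_le_sq (by nlinarith) (by linarith)
  · intro hr
    have hδ : 0 ≤ δ := (abs_nonneg r).trans hr
    have hsq : r ^ 2 ≤ δ ^ 2 := sq_le_sq' (abs_le.mp hr).1 (abs_le.mp hr).2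
    refine Matrix.PosSemidef.of_dotProduct_mulVec_nonneg ?_ fun x => ?_
    · ext i j
      fin_cases i <;> fin_cases j <;> simp
    · have hcs : |p * (x 0 ^ 2 - x 1 ^ 2) + b * (2 * x 0 * x 1)| ≤ δ * (x 0 ^ 2 + x 1 ^ 2) := by
        refine abs_le_of_sq_le_sq ?_ (by positivity)
        have hmul := mul_le_mul_of_nonneg_right (h.trans_le hsq) (sq_nonneg (x 0 ^ 2 + x 1 ^ 2))
        nlinarith [sq_nonneg (p * (2 * x 0 * x 1) - b * (x 0 ^ 2 - x 1 ^ 2))]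
      have hlow := (abs_le.mp hcs).1
      simp only [dotProduct, mulVec, Fin.sum_univ_two, Pi.star_apply, star_trivial, of_apply,
        cons_val_zero, cons_val_one]
      linarith

/-- `Jr(φ) − Jr(φ̂) + δ·I` is positive semidefinite iff `δ ≥ |sin(φ − φ̂)|`. -/
theorem jr_sub_jr_add_smul_one_posSemidef_iff (φ φhat δ : ℝ) :
    (Jrm φ - Jrm φhat + δ • (1 : Matrix (Fin 2) (Fin 2) ℝ)).PosSemidef ↔
      |Real.sin (φ - φhat)| ≤ δ := by
  have hM : Jrm φ - Jrm φhat + δ • (1 : Matrix (Fin 2) (Fin 2) ℝ) =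
      !![δ + (cos φ ^ 2 - cos φhat ^ 2), cos φ * sin φ - cos φhat * sin φhat;
        cos φ * sin φ - cos φhat * sin φhat, δ - (cos φ ^ 2 - cos φhat ^ 2)] := by
    have h₁ := sin_sq_add_cos_sq φ
    have h₂ := sin_sq_add_cos_sq φhat
    ext i j
    fin_cases i <;> fin_cases j <;> simp [Jrm, uvec] <;> linarith
  rw [hM]
  refine posSemidef_fin_two_iff_abs_le δ ?_
  rw [sin_sub]
  have h₁ : sin φ ^ 2 = 1 - cos φ ^ 2 := sin_sq φ
  have h₂ : sin φhat ^ 2 = 1 - cos φhat ^ 2 := sin_sq φhat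
  linear_combination (cos φ ^ 2 - cos φhat ^ 2) * h₁ + (cos φhat ^ 2 - cos φ ^ 2) * h₂
end

section
/- Let φ_j, φ̂_j ∈ ℝ, ε_j ∈ [0, π/2], δ_j ∈ ℝ, and c_j ≥ 0 for j = 1, …, N. Suppose |φ_j − φ̂_j| ≤ ε_j and δ_j ≥ sin(ε_j) for every j, and that the matrix ∑_j c_j (Jr(φ̂_j) − δ_j·I) is positive definite. Then ∑_j c_j Jr(φ_j) is positive definite and trace( (∑_j c_j Jr(φ_j))⁻¹ ) ≤ trace( (∑_j c_j (Jr(φ̂_j) − δ_j·I))⁻¹ ). -/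
open Matrix Real BigOperators

/-- If `B` is positive definite and `A - B` is positive semidefinite, then `B⁻¹ - A⁻¹` is positive
semidefinite. -/
theorem Matrix.PosDef.posSemidef_inv_sub_inv {n : Type*} [Fintype n] [DecidableEq n]
    {A B : Matrix n n ℝ} (hA : A.PosDef) (hB : B.PosDef) (hAB : (A - B).PosSemidef) :
    (B⁻¹ - A⁻¹).PosSemidef := by
  have hAu : IsUnit A.det := A.isUnit_iff_isUnit_det.mp hA.isUnit
  have hBu : IsUnit B.det := B.isUnit_iff_isUnit_det.mp hB.isUnit
  have hdecomp : B⁻¹ - A⁻¹ = (B⁻¹ - A⁻¹) * B * (B⁻¹ - A⁻¹) + A⁻¹ * (A - B) * A⁻¹ := by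
    simp only [Matrix.sub_mul, Matrix.mul_sub, Matrix.nonsing_inv_mul _ hAu,
      Matrix.nonsing_inv_mul _ hBu, Matrix.mul_assoc,
      Matrix.mul_nonsing_inv _ hBu, Matrix.mul_one, Matrix.one_mul]
    abel
  have hAinv : A⁻¹ᴴ = A⁻¹ := hA.inv.isHermitian
  have hBinv : B⁻¹ᴴ = B⁻¹ := hB.inv.isHermitian
  have h₁ := hB.posSemidef.conjTranspose_mul_mul_same (B⁻¹ - A⁻¹)
  have h₂ := hAB.conjTranspose_mul_mul_same A⁻¹
  rw [conjTranspose_sub, hAinv, hBinv] at h₁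
  rw [hAinv] at h₂
  rw [hdecomp]
  exact h₁.add h₂

/-- The inverse trace is antitone on positive definite matrices. -/
theorem Matrix.PosDef.trace_inv_le_trace_inv {n : Type*} [Fintype n] [DecidableEq n]
    {A B : Matrix n n ℝ} (hA : A.PosDef) (hB : B.PosDef) (hAB : (A - B).PosSemidef) :
    A⁻¹.trace ≤ B⁻¹.trace := by
  have h := (hA.posSemidef_inv_sub_inv hB hAB).trace_nonneg
  rwa [trace_sub, sub_nonneg] at h

/-- A rotation of the ranging direction by at most `ε ≤ π / 2` decreases `Jrm` by at most
`sin ε` in the Loewner order. -/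
theorem posSemidef_Jrm_sub_Jrm_sub_smul_one {φ ψ ε δ : ℝ} (hε : ε ≤ π / 2)
    (h : |φ - ψ| ≤ ε) (hδ : Real.sin ε ≤ δ) :
    (Jrm φ - (Jrm ψ - δ • (1 : Matrix (Fin 2) (Fin 2) ℝ))).PosSemidef := by
  obtain ⟨hlo, hhi⟩ := abs_le.mp h
  have hsin : Real.sin (φ - ψ) ≤ δ :=
    (Real.sin_le_sin_of_le_of_le_pi_div_two (by linarith) hε hhi).trans hδ
  have hsin' : -δ ≤ Real.sin (φ - ψ) := by
    have := Real.sin_le_sin_of_le_of_le_pi_div_two (by linarith) (by linarith) hlo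
    rw [Real.sin_neg] at this
    linarith
  refine .of_dotProduct_mulVec_nonneg ?_ fun x ↦ ?_
  · ext i j
    fin_cases i <;> fin_cases j <;> simp [Jrm, uvec, mul_comm]
  · set p := x 0 ^ 2 + x 1 ^ 2 with hp
    set q := (x 1 ^ 2 - x 0 ^ 2) * Real.sin (φ + ψ) + 2 * x 0 * x 1 * Real.cos (φ + ψ) with hq
    have hqp : |q| ≤ p := by
      refine abs_le_of_sq_le_sq ?_ (by positivity)
      have := Real.sin_sq_add_cos_sq (φ + ψ)
      have hsq : p ^ 2 - q ^ 2 =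
          ((x 1 ^ 2 - x 0 ^ 2) * Real.cos (φ + ψ) - 2 * x 0 * x 1 * Real.sin (φ + ψ)) ^ 2 := by
        rw [hp, hq]
        linear_combination (-(x 0 ^ 2 + x 1 ^ 2) ^ 2) * this
      nlinarith [sq_nonneg
        ((x 1 ^ 2 - x 0 ^ 2) * Real.cos (φ + ψ) - 2 * x 0 * x 1 * Real.sin (φ + ψ))]
    have hform : star x ⬝ᵥ (Jrm φ - (Jrm ψ - δ • (1 : Matrix (Fin 2) (Fin 2) ℝ))) *ᵥ x =
        Real.sin (φ - ψ) * q + δ * p := by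
      have h₁ := Real.sin_sq_add_cos_sq φ
      have h₂ := Real.sin_sq_add_cos_sq ψ
      simp [Jrm, uvec, dotProduct, mulVec, Fin.sum_univ_two, hp, hq,
        Real.sin_sub, Real.sin_add, Real.cos_add]
      linear_combination (x 0 * Real.cos ψ + x 1 * Real.sin ψ) ^ 2 * h₁ -
        (x 0 * Real.cos φ + x 1 * Real.sin φ) ^ 2 * h₂
    rw [hform]
    have hprod : |Real.sin (φ - ψ) * q| ≤ δ * p := by
      rw [abs_mul]
      exact mul_le_mul (abs_le.mpr ⟨hsin', hsin⟩) hqp (abs_nonneg _) (by linarith)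
    linarith [neg_abs_le (Real.sin (φ - ψ) * q)]

/-- If `|φ_j − φ̂_j| ≤ ε_j`, `δ_j ≥ sin ε_j`, `c_j ≥ 0`, and
`∑ j, c j • (Jr(φ̂_j) − δ_j·I)` is positive definite, then `∑ j, c j • Jr(φ_j)` is positive
definite and its inverse has trace bounded by that of the robust surrogate. -/
theorem robust_surrogate_bounds_speb
    (N : ℕ) (φ φhat ε δ c : Fin N → ℝ)
    (hε : ∀ j, ε j ∈ Set.Icc (0 : ℝ) (π / 2))
    (hc : ∀ j, 0 ≤ c j)
    (hangle : ∀ j, |φ j - φhat j| ≤ ε j)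
    (hδ : ∀ j, Real.sin (ε j) ≤ δ j)
    (hpd : (∑ j, c j • (Jrm (φhat j) - δ j • (1 : Matrix (Fin 2) (Fin 2) ℝ))).PosDef) :
    (∑ j, c j • Jrm (φ j)).PosDef ∧
    (∑ j, c j • Jrm (φ j))⁻¹.trace ≤
      (∑ j, c j • (Jrm (φhat j) - δ j • (1 : Matrix (Fin 2) (Fin 2) ℝ)))⁻¹.trace := by
  have hsub : (∑ j, c j • Jrm (φ j) -
      ∑ j, c j • (Jrm (φhat j) - δ j • (1 : Matrix (Fin 2) (Fin 2) ℝ))).PosSemidef := by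
    rw [← Finset.sum_sub_distrib]
    refine posSemidef_sum _ fun j _ ↦ ?_
    rw [← smul_sub]
    exact (posSemidef_Jrm_sub_Jrm_sub_smul_one (hε j).2 (hangle j) (hδ j)).smul (hc j)
  have hpd' : (∑ j, c j • Jrm (φ j)).PosDef := by
    simpa using hpd.add_posSemidef hsub
  exact ⟨hpd', hpd'.trace_inv_le_trace_inv hpd hsub⟩
end
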